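/- Assume the split type: n odd with ε = −1, or n even with ε = +1. Let M be an ε-representation of the equioriented type A_n quiver with underlying graded space (M^0, ⟨−,−⟩), let 1 ≤ q ≤ n, set L := U_{q,n}, and suppose there exists an injective morphism L → M. Then: (a) for every injective morphism ι : L → M, the graded subspace ι(L)^0 := ⊕_p ι_p(L_p) is isotropic, and ι(L)^⊥ := {m ∈ M^0 : ⟨m, x⟩ = 0 for all x ∈ ι(L)^0} is a graded subspace of M^0 which is a subrepresentation of M containing ι(L)^0; (b) there exists an injective morphism ι : L → M such that the quotient representation M(1) := ι(L)^⊥/ι(L) (with components (ι(L)^⊥ ∩ M_p)/ι_p(L_p) and maps induced by the f^M_p) has rank sequence given, for all 1 ≤ k ≤ ℓ ≤ n, by: r^{M(1)}_{k,ℓ} = r^M_{k,ℓ} − 2 if both r^M_{q,ℓ} ≤ r^M_{k,ℓ} and r^M_{k,σ(q)} ≤ r^M_{k,ℓ}; r^{M(1)}_{k,ℓ} = r^M_{k,ℓ} − 1 if exactly one of these two inequalities holds; and r^{M(1)}_{k,ℓ} = r^M_{k,ℓ} otherwise; here the convention r^M_{s,t} := +∞ for s > t is used. -/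

import Mathlib

open Module

/-- A representation of the equioriented type `A_n` quiver over `ℂ`: finite-dimensional
complex vector spaces `V i` (only the indices `1 ≤ i ≤ n` carry content, the spaces at
index `0` and at indices `> n` are required to be trivial) together with linear maps
`f i : V i → V (i+1)`. -/
structure ARep (n : ℕ) where
  V : ℕ → Type
  [instAddCommGroup : ∀ i, AddCommGroup (V i)]
  [instModule : ∀ i, Module ℂ (V i)]
  [instFiniteDimensional : ∀ i, FiniteDimensional ℂ (V i)]
  f : ∀ i, V i →ₗ[ℂ] V (i + 1)
  triv : ∀ i, i = 0 ∨ n < i → Subsingleton (V i)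

attribute [instance] ARep.instAddCommGroup ARep.instModule ARep.instFiniteDimensional

namespace ARep

/-- The composite map `f_{i,i+k} : M_i → M_{i+k}` (the identity for `k = 0`). -/
noncomputable def F {n : ℕ} (M : ARep n) (i : ℕ) : (k : ℕ) → (M.V i →ₗ[ℂ] M.V (i + k))
  | 0 => LinearMap.id
  | (k + 1) => (M.f (i + k)).comp (M.F i k)

/-- The rank sequence `r^M_{i,j} = rank f_{i,j}`.  (For `i = 0` the source space is
trivial and for `j = n+1` the target space is trivial, so the conventions
`r^M_{0,·} = 0 = r^M_{·,n+1}` hold automatically.) -/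
noncomputable def r {n : ℕ} (M : ARep n) (i j : ℕ) : ℕ :=
  Module.finrank ℂ (LinearMap.range (M.F i (j - i)))

end ARep

/-- A morphism of representations of the equioriented type `A_n` quiver. -/
structure ARepHom {n : ℕ} (M N : ARep n) where
  φ : ∀ i, M.V i →ₗ[ℂ] N.V i
  comm : ∀ i, (φ (i + 1)).comp (M.f i) = (N.f i).comp (φ i)

/-- Two representations are isomorphic if there is a morphism all of whose components
are bijective. -/
def ARepIso {n : ℕ} (M N : ARep n) : Prop :=
  ∃ h : ARepHom M N, ∀ i, Function.Bijective (h.φ i)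

/-- The condition for the interval representation `U_{i,j}` to have a nonzero space at
vertex `k`. -/
def Ucond (n i j k : ℕ) : Prop := 1 ≤ k ∧ k ≤ n ∧ i ≤ k ∧ k ≤ j

instance (n i j k : ℕ) : Decidable (Ucond n i j k) := by unfold Ucond; infer_instance

/-- The space of `U_{i,j}` at vertex `k`, realized as a submodule of `ℂ`. -/
noncomputable def Uspace (n i j k : ℕ) : Submodule ℂ ℂ := if Ucond n i j k then ⊤ else ⊥

/-- The indecomposable interval representation `U_{i,j}` (for `1 ≤ i ≤ j ≤ n`):
one-dimensional at the vertices `i ≤ k ≤ j`, zero elsewhere, with identity structure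
maps inside the interval. -/
noncomputable def Urep (n i j : ℕ) : ARep n where
  V k := ↥(Uspace n i j k)
  f k := LinearMap.restrict
    (if Ucond n i j k ∧ Ucond n i j (k + 1) then (LinearMap.id : ℂ →ₗ[ℂ] ℂ) else 0)
    (p := Uspace n i j k) (q := Uspace n i j (k + 1))
    (by
      intro x hx
      by_cases h : Ucond n i j k ∧ Ucond n i j (k + 1)
      · rw [if_pos h]
        simp [Uspace, if_pos h.2]
      · rw [if_neg h]
        simp)
  triv k hk := by
    have hbot : Uspace n i j k = ⊥ := by
      simp only [Uspace]; rw [if_neg]; unfold Ucond; omega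
    have h0 := (Submodule.eq_bot_iff _).mp hbot
    exact ⟨fun a b => Subtype.ext ((h0 a.1 a.2).trans (h0 b.1 b.2).symm)⟩

/-- The componentwise direct sum of two representations. -/
noncomputable def ARep.dsum {n : ℕ} (M N : ARep n) : ARep n where
  V i := M.V i × N.V i
  f i := (M.f i).prodMap (N.f i)
  triv i hi := by
    haveI := M.triv i hi
    haveI := N.triv i hi
    exact ⟨fun a b => Prod.ext (Subsingleton.elim _ _) (Subsingleton.elim _ _)⟩

/-- A representation is nonzero if some vector space is nonzero. -/
def ARep.Nonzero {n : ℕ} (M : ARep n) : Prop := ∃ i, ∃ v : M.V i, v ≠ 0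

/-- The index set of segments `1 ≤ i ≤ j ≤ n`. -/
def SegIdx (n : ℕ) : Type :=
  {p : Fin (n + 1) × Fin (n + 1) // 1 ≤ p.1.1 ∧ p.1.1 ≤ p.2.1}

instance (n : ℕ) : Fintype (SegIdx n) := by unfold SegIdx; infer_instance

/-- The direct sum `⊕_{1 ≤ i ≤ j ≤ n} U_{i,j}^{⊕ m i j}`, taken componentwise. -/
noncomputable def sumU (n : ℕ) (m : ℕ → ℕ → ℕ) : ARep n where
  V k := ∀ p : SegIdx n, Fin (m p.1.1.1 p.1.2.1) → (Urep n p.1.1.1 p.1.2.1).V k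
  f k := LinearMap.pi fun p =>
    (((Urep n p.1.1.1 p.1.2.1).f k).compLeft (Fin (m p.1.1.1 p.1.2.1))).comp
      (LinearMap.proj p)
  triv k hk := by
    haveI := fun p : SegIdx n => (Urep n p.1.1.1 p.1.2.1).triv k hk
    exact ⟨fun a b => funext fun p => Subsingleton.elim _ _⟩

/-- The space of morphisms `Hom(M,N)` realized as a subspace of the product of the
spaces of componentwise linear maps. -/
noncomputable def HomSubspace {n : ℕ} (M N : ARep n) :
    Submodule ℂ (∀ k, M.V k →ₗ[ℂ] N.V k) where
  carrier := {φ | ∀ k, (φ (k + 1)).comp (M.f k) = (N.f k).comp (φ k)}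
  add_mem' := by
    intro a b ha hb k
    simp only [Pi.add_apply, LinearMap.add_comp, LinearMap.comp_add, ha k, hb k]
  zero_mem' := by
    intro k
    simp
  smul_mem' := by
    intro c a ha k
    simp only [Pi.smul_apply, LinearMap.smul_comp, LinearMap.comp_smul, ha k]

/-- The quotient of a representation by a family of subspaces stable under the
structure maps. -/
noncomputable def ARep.quot {n : ℕ} (M : ARep n) (S : ∀ k, Submodule ℂ (M.V k))
    (h : ∀ k, S k ≤ (S (k + 1)).comap (M.f k)) : ARep n where
  V k := M.V k ⧸ S k
  f k := Submodule.mapQ (S k) (S (k + 1)) (M.f k) (h k)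
  triv k hk := by
    haveI := M.triv k hk
    refine ⟨fun a b => ?_⟩
    obtain ⟨x, rfl⟩ := Submodule.Quotient.mk_surjective _ a
    obtain ⟨y, rfl⟩ := Submodule.Quotient.mk_surjective _ b
    exact congrArg _ (Subsingleton.elim x y)

/-- The quotient `M / ι(L)` of `M` by the image of a morphism `ι : L → M`. -/
noncomputable def quotByHom {n : ℕ} {L M : ARep n} (ι : ARepHom L M) : ARep n :=
  M.quot (fun k => LinearMap.range (ι.φ k)) (by
    intro k x hx
    obtain ⟨y, rfl⟩ := hx
    rw [Submodule.mem_comap]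
    exact ⟨L.f k y, LinearMap.congr_fun (ι.comm k) y⟩)

/-- The subrepresentation of `M` given by a family of subspaces stable under the
structure maps. -/
noncomputable def ARep.sub {n : ℕ} (M : ARep n) (N : ∀ i, Submodule ℂ (M.V i))
    (h : ∀ i, ∀ x ∈ N i, M.f i x ∈ N (i + 1)) : ARep n where
  V i := ↥(N i)
  f i := (M.f i).restrict (h i)
  triv i hi := by
    haveI := M.triv i hi
    exact ⟨fun a b => Subtype.ext (Subsingleton.elim _ _)⟩

/-- The subquotient representation `P/S` of `M`, for families of subspaces
`S k ≤ P k` both stable under the structure maps. -/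
noncomputable def ARep.subquot {n : ℕ} (M : ARep n) (P S : ∀ k, Submodule ℂ (M.V k))
    (hSP : ∀ k, S k ≤ P k)
    (hP : ∀ k, ∀ x ∈ P k, M.f k x ∈ P (k + 1))
    (hS : ∀ k, ∀ x ∈ S k, M.f k x ∈ S (k + 1)) : ARep n where
  V k := ↥(P k) ⧸ (S k).comap (P k).subtype
  f k := Submodule.mapQ _ _ ((M.f k).restrict (hP k)) (by
    intro x hx
    rw [Submodule.mem_comap] at hx ⊢
    exact hS k x.1 hx)
  triv k hk := by
    haveI := M.triv k hk
    haveI : Subsingleton (↥(P k)) := ⟨fun a b => Subtype.ext (Subsingleton.elim _ _)⟩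
    refine ⟨fun a b => ?_⟩
    obtain ⟨x, rfl⟩ := Submodule.Quotient.mk_surjective _ a
    obtain ⟨y, rfl⟩ := Submodule.Quotient.mk_surjective _ b
    exact congrArg _ (Subsingleton.elim x y)

/-- A `σ`-compatible `ε`-form on the underlying graded vector space of `M` making `M`
an `ε`-representation: a nondegenerate bilinear form `B` on `M^0 = ⊕_i M_i` with
`B v w = ε B w v`, with `B (M_i) (M_j) = 0` unless `i + j = n + 1` (i.e. `j = σ(i)`),
and anti-compatible with the structure maps. -/
structure EpsForm (n : ℕ) (M : ARep n) (ε : ℂ) where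
  B : (∀ i, M.V i) →ₗ[ℂ] (∀ i, M.V i) →ₗ[ℂ] ℂ
  nondeg : ∀ v, (∀ w, B v w = 0) → v = 0
  eps_symm : ∀ v w, B v w = ε * B w v
  graded : ∀ (i j : ℕ) (v : M.V i) (w : M.V j), i + j ≠ n + 1 →
    B (Pi.single i v) (Pi.single j w) = 0
  compat : ∀ i, 1 ≤ i → i + 1 ≤ n → ∀ (v : M.V i) (w : M.V (n - i)),
    B (Pi.single (i + 1) (M.f i v)) (Pi.single (n - i) w)
      + B (Pi.single i v) (Pi.single (n - i + 1) (M.f (n - i) w)) = 0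

/-- The orthogonal complement, at vertex `p`, of the image of a morphism `ι : L → M`
with respect to the form `E`. -/
noncomputable def perpAt {n : ℕ} {L M : ARep n} {ε : ℂ} (E : EpsForm n M ε)
    (ι : ARepHom L M) (p : ℕ) : Submodule ℂ (M.V p) where
  carrier := {y | ∀ (q : ℕ) (x : M.V q), x ∈ LinearMap.range (ι.φ q) →
    E.B (Pi.single p y) (Pi.single q x) = 0}
  add_mem' := by
    intro a b ha hb q x hx
    rw [Pi.single_add, map_add, LinearMap.add_apply, ha q x hx, hb q x hx, add_zero]
  zero_mem' := by
    intro q x hx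
    rw [Pi.single_zero, map_zero, LinearMap.zero_apply]
  smul_mem' := by
    intro c a ha q x hx
    rw [Pi.single_smul, map_smul, LinearMap.smul_apply, ha q x hx, smul_zero]



namespace ARep

/-- Total version of the composite maps; zero if `j < i`. -/
noncomputable def G {n : ℕ} (M : ARep n) (i : ℕ) : (j : ℕ) → (M.V i →ₗ[ℂ] M.V j)
  | 0 => if h : i = 0 then h ▸ LinearMap.id else 0
  | (j + 1) => if h : i = j + 1 then h ▸ LinearMap.id else (M.f j).comp (M.G i j)

variable {n : ℕ} (M : ARep n)

theorem G_self (i : ℕ) : M.G i i = LinearMap.id := by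
  cases i <;> simp [G]

theorem G_succ {i j : ℕ} (h : i ≤ j) : M.G i (j + 1) = (M.f j).comp (M.G i j) := by
  rw [G, dif_neg (by omega)]

theorem G_lt {i j : ℕ} (h : j < i) : M.G i j = 0 := by
  induction j with
  | zero => rw [G, dif_neg (by omega)]
  | succ j ih => rw [G, dif_neg (by omega), ih (by omega), LinearMap.comp_zero]

theorem F_eq_G (i d : ℕ) : M.F i d = M.G i (i + d) := by
  induction d with
  | zero => exact (M.G_self i).symm
  | succ d ih =>
    rw [F, ih]
    exact (M.G_succ (by omega)).symm

theorem G_comp {i j l : ℕ} (hij : i ≤ j) (hjl : j ≤ l) (x : M.V i) :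
    M.G j l (M.G i j x) = M.G i l x := by
  induction l, hjl using Nat.le_induction with
  | base => rw [G_self]; rfl
  | succ l hl ih => rw [G_succ _ hl, G_succ _ (hij.trans hl), LinearMap.comp_apply, ih]; rfl

theorem G_f {i l : ℕ} (h : i + 1 ≤ l) (x : M.V i) : M.G (i + 1) l (M.f i x) = M.G i l x := by
  rw [← M.G_comp (Nat.le_succ i) h, G_succ _ le_rfl, G_self]; rfl

theorem r_eq {i j : ℕ} (h : i ≤ j) : M.r i j = finrank ℂ (LinearMap.range (M.G i j)) := by
  obtain ⟨d, rfl⟩ := Nat.exists_eq_add_of_le h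
  rw [r, Nat.add_sub_cancel_left, F_eq_G]

theorem r_le_iff_range {q k l : ℕ} (hk : k ≤ l) (hq : q ≤ l) :
    M.r q l ≤ M.r k l ↔ LinearMap.range (M.G q l) ≤ LinearMap.range (M.G k l) := by
  rw [r_eq _ hk, r_eq _ hq]
  have key : ∀ a b, a ≤ b → b ≤ l → LinearMap.range (M.G a l) ≤ LinearMap.range (M.G b l) := by
    rintro a b hab hb _ ⟨x, rfl⟩
    exact ⟨M.G a b x, M.G_comp hab hb x⟩
  refine ⟨fun h => ?_, fun h => Submodule.finrank_mono h⟩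
  rcases le_total q k with hqk | hqk
  · exact key _ _ hqk hk
  · exact (Submodule.eq_of_le_of_finrank_le (key _ _ hqk hq) h).ge

theorem r_le_iff_ker {k l m : ℕ} (hk : k ≤ l) (hm : k ≤ m) :
    M.r k m ≤ M.r k l ↔ LinearMap.ker (M.G k l) ≤ LinearMap.ker (M.G k m) := by
  rw [r_eq _ hk, r_eq _ hm]
  have h1 := LinearMap.finrank_range_add_finrank_ker (M.G k l)
  have h2 := LinearMap.finrank_range_add_finrank_ker (M.G k m)
  have key : ∀ a b, k ≤ a → a ≤ b → LinearMap.ker (M.G k a) ≤ LinearMap.ker (M.G k b) := by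
    intro a b ha hab x hx
    rw [LinearMap.mem_ker] at hx ⊢
    rw [← M.G_comp ha hab, hx, map_zero]
  constructor
  · intro h
    rcases le_total l m with hlm | hlm
    · exact key _ _ hk hlm
    · exact (Submodule.eq_of_le_of_finrank_le (key _ _ hm hlm) (by omega)).ge
  · intro h
    have := Submodule.finrank_mono h
    omega

theorem finrank_map_ker {V W : Type} [AddCommGroup V] [Module ℂ V] [FiniteDimensional ℂ V]
    [AddCommGroup W] [Module ℂ W] [FiniteDimensional ℂ W] (T : V →ₗ[ℂ] W) (φ : V →ₗ[ℂ] ℂ) 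
    (h1 : φ ≠ 0) (h2 : LinearMap.ker T ≤ LinearMap.ker φ) :
    finrank ℂ ((LinearMap.ker φ).map T) + 1 = finrank ℂ (LinearMap.range T) := by
  have e1 := LinearMap.finrank_range_add_finrank_ker T
  have e2 := LinearMap.finrank_range_add_finrank_ker (T.domRestrict (LinearMap.ker φ))
  have e3 := LinearMap.finrank_range_add_finrank_ker φ
  have e4 : finrank ℂ (LinearMap.range φ) = 1 := by
    rw [LinearMap.range_eq_top.mpr (LinearMap.surjective h1)]; simp
  have e5 : LinearMap.range (T.domRestrict (LinearMap.ker φ)) = (LinearMap.ker φ).map T := by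
    ext x; simp
  have e6 : finrank ℂ (LinearMap.ker (T.domRestrict (LinearMap.ker φ)))
      = finrank ℂ (LinearMap.ker T) := by
    have : LinearMap.ker (T.domRestrict (LinearMap.ker φ))
      = (LinearMap.ker T).comap (LinearMap.ker φ).subtype := by ext x; simp
    rw [this]
    exact (Submodule.comapSubtypeEquivOfLe h2).finrank_eq
  rw [e5] at e2
  omega

theorem map_ker_eq_range {V W : Type} [AddCommGroup V] [Module ℂ V] 
    [AddCommGroup W] [Module ℂ W]  (T : V →ₗ[ℂ] W) (φ : V →ₗ[ℂ] ℂ) 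
    (h : ¬ (φ ≠ 0 ∧ LinearMap.ker T ≤ LinearMap.ker φ)) :
    (LinearMap.ker φ).map T = LinearMap.range T := by
  by_cases h1 : φ = 0
  · subst h1; simp
  · have h2 : ¬ LinearMap.ker T ≤ LinearMap.ker φ := fun h2 => h ⟨h1, h2⟩
    obtain ⟨z, hz, hz'⟩ := SetLike.not_le_iff_exists.mp h2
    rw [LinearMap.mem_ker] at hz hz'
    refine le_antisymm (LinearMap.map_le_range) ?_
    rintro _ ⟨x, rfl⟩
    refine ⟨x - (φ x / φ z) • z, ?_, ?_⟩
    · simp [hz']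
    · simp [hz]

theorem exists_avoid {V : Type} [AddCommGroup V] [Module ℂ V] (S : Set (Submodule ℂ V))
    (hS : S.Finite) (h : ⊤ ∉ S) : ∃ v : V, ∀ W ∈ S, v ∉ W := by
  by_contra! hc
  refine Subspace.biUnion_ne_univ_of_top_notMem (s := hS.toFinset) (by simpa using h) ?_
  ext v
  simpa using hc v

end ARep

namespace EpsForm

variable {n : ℕ} {M : ARep n} {ε : ℂ} (E : EpsForm n M ε)

/-- The component of the form pairing `M_p` and `M_p'`. -/
noncomputable def b (p p' : ℕ) : M.V p →ₗ[ℂ] M.V p' →ₗ[ℂ] ℂ :=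
  E.B.compl₁₂ (LinearMap.single ℂ M.V p) (LinearMap.single ℂ M.V p')

theorem b_apply (p p' : ℕ) (x : M.V p) (y : M.V p') :
    E.b p p' x y = E.B (Pi.single p x) (Pi.single p' y) := rfl

theorem b_graded {p p' : ℕ} (h : p + p' ≠ n + 1) (x : M.V p) (y : M.V p') :
    E.b p p' x y = 0 := E.graded p p' x y h

theorem b_symm (p p' : ℕ) (x : M.V p) (y : M.V p') :
    E.b p p' x y = ε * E.b p' p y x := E.eps_symm _ _

theorem b_f (i i' : ℕ) (x : M.V i) (y : M.V i') :
    E.b (i + 1) i' (M.f i x) y = - E.b i (i' + 1) x (M.f i' y) := by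
  by_cases h : i + i' = n
  · by_cases hi : i = 0
    · have := M.triv i (Or.inl hi)
      rw [Subsingleton.elim x 0]; simp
    · by_cases hi' : i' = 0
      · have := M.triv i' (Or.inl hi')
        rw [Subsingleton.elim y 0]; simp
      · obtain rfl : i' = n - i := by omega
        exact eq_neg_of_add_eq_zero_left (E.compat i (by omega) (by omega) x y)
  · rw [b_graded _ (by omega), b_graded _ (by omega), neg_zero]

theorem b_G (d : ℕ) : ∀ (i j j' i' : ℕ), j = i + d → i' = j' + d → 
    ∀ (x : M.V i) (y : M.V j'),
    E.b j j' (M.G i j x) y = (-1) ^ d * E.b i i' x (M.G j' i' y) := by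
  induction d with
  | zero => 
    rintro i j j' i' rfl rfl x y
    simp [ARep.G_self]
  | succ d ih =>
    rintro i j j' i' rfl hi' x y
    have : M.G i (i + (d + 1)) = (M.f (i + d)).comp (M.G i (i + d)) := M.G_succ (Nat.le_add_right i d)
    rw [this, LinearMap.comp_apply]
    refine (E.b_f (i + d) j' _ y).trans ?_
    rw [ih i (i + d) (j' + 1) i' rfl (by omega), M.G_f (by omega)]
    ring

theorem b_G_zero {i j j' i' : ℕ} (hij : i ≤ j) (hs : i + i' = j + j') 
    (x : M.V i) (y : M.V j') :
    E.b j j' (M.G i j x) y = 0 ↔ E.b i i' x (M.G j' i' y) = 0 := by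
  rw [E.b_G (j - i) i j j' i' (by omega) (by omega)]
  simp

theorem sum_single (w : ∀ i, M.V i) : w = ∑ i ∈ Finset.range (n + 1), Pi.single i (w i) := by
  funext j
  rw [Finset.sum_apply]
  by_cases hj : j ∈ Finset.range (n + 1)
  · rw [Finset.sum_eq_single j]
    · simp
    · intro i _ hi
      exact Pi.single_eq_of_ne (Ne.symm hi) _
    · exact fun h => absurd hj h
  · have := M.triv j (Or.inr (by simpa using hj))
    exact Subsingleton.elim _ _

theorem b_nondeg {p p' : ℕ} (h : p + p' = n + 1) (x : M.V p) (hx : ∀ y, E.b p p' x y = 0) :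
    x = 0 := by
  have : (Pi.single p x : ∀ i, M.V i) = 0 := by
    apply E.nondeg
    intro w
    rw [sum_single w, map_sum]
    refine Finset.sum_eq_zero fun i _ => ?_
    by_cases hi : i = p'
    · subst hi; exact hx _
    · exact E.b_graded (by omega) _ _
  simpa using this

theorem b_nondeg' {p p' : ℕ} (h : p + p' = n + 1) (y : M.V p')
    (hy : ∀ x, E.b p p' x y = 0) : y = 0 := by
  refine E.b_nondeg (p' := p) (by omega) y fun x => ?_
  rw [b_symm, hy, mul_zero]

theorem b_surj {p p' : ℕ} (h : p + p' = n + 1) (φ : M.V p' →ₗ[ℂ] ℂ) :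
    ∃ x, E.b p p' x = φ := by
  have i1 : Function.Injective (E.b p p') := by
    rw [injective_iff_map_eq_zero]
    intro x hx
    exact E.b_nondeg h x fun y => by rw [hx]; rfl
  have i2 : Function.Injective (E.b p p').flip := by
    rw [injective_iff_map_eq_zero]
    intro y hy
    exact E.b_nondeg' h y fun x => by rw [← LinearMap.flip_apply, hy]; rfl
  have d1 := LinearMap.finrank_le_finrank_of_injective i1
  have d2 := LinearMap.finrank_le_finrank_of_injective i2
  have e1 : finrank ℂ (M.V p →ₗ[ℂ] ℂ) = finrank ℂ (M.V p) := Subspace.dual_finrank_eq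
  have e2 : finrank ℂ (M.V p' →ₗ[ℂ] ℂ) = finrank ℂ (M.V p') := Subspace.dual_finrank_eq
  exact (LinearMap.injective_iff_surjective_of_finrank_eq_finrank (by omega)).mp i1 φ

theorem mem_range_of_perp {k l k' l' : ℕ} (hk : k + k' = n + 1) (hl : l + l' = n + 1)
    (hkl : k ≤ l) (x : M.V k') (hx : ∀ y ∈ LinearMap.ker (M.G k l), E.b k k' y x = 0) :
    ∃ u, M.G l' k' u = x := by
  by_contra hc
  have hx' : x ∉ LinearMap.range (M.G l' k') := hc
  obtain ⟨φ, hφ, hφ'⟩ := Submodule.exists_le_ker_of_notMem hx'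
  obtain ⟨y, rfl⟩ := E.b_surj hk φ
  apply hφ
  apply hx
  rw [LinearMap.mem_ker]
  refine E.b_nondeg hl _ fun u => ?_
  rw [E.b_G_zero (i' := k') hkl (by omega)]
  exact hφ' ⟨u, rfl⟩

theorem isotropic_aux (hsplit : (Odd n ∧ ε = -1) ∨ (Even n ∧ ε = 1)) {q p p' : ℕ} (v : M.V q)
    (hp : q ≤ p) (hpp : p ≤ p') : E.b p p' (M.G q p v) (M.G q p' v) = 0 := by
  by_cases h : p + p' = n + 1
  · have h1 := E.b_G (p' - p) p p' p p' (by omega) (by omega) (M.G q p v) (M.G q p v)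
    rw [M.G_comp hp hpp, b_symm] at h1
    obtain ⟨d, rfl⟩ := Nat.exists_eq_add_of_le hpp
    rw [Nat.add_sub_cancel_left] at h1
    rcases hsplit with ⟨ho, rfl⟩ | ⟨he, rfl⟩
    · have : Even d := by
        rcases ho with ⟨a, ha⟩
        exact ⟨a + 1 - p, by omega⟩
      rw [this.neg_one_pow] at h1
      linear_combination (-1/2) * h1
    · have : Odd d := by
        rcases he with ⟨a, ha⟩
        exact ⟨a - p, by omega⟩
      rw [this.neg_one_pow] at h1
      linear_combination (1/2) * h1
  · exact E.b_graded h _ _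

theorem isotropic (hsplit : (Odd n ∧ ε = -1) ∨ (Even n ∧ ε = 1)) {q p p' : ℕ} (v : M.V q) :
    E.b p p' (M.G q p v) (M.G q p' v) = 0 := by
  by_cases hp : q ≤ p
  · by_cases hp' : q ≤ p'
    · rcases le_total p p' with h | h
      · exact E.isotropic_aux hsplit v hp h
      · rw [b_symm, E.isotropic_aux hsplit v hp' h, mul_zero]
    · rw [M.G_lt (j := p') (by omega)]; simp
  · rw [M.G_lt (j := p) (by omega)]; simp

end EpsForm

namespace ARep

variable {n : ℕ} (M : ARep n)

/-- The coordinate on the spaces of the interval representation. -/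
noncomputable def uval (n q p : ℕ) : (Urep n q n).V p →ₗ[ℂ] ℂ := (Uspace n q n p).subtype

theorem uval_inj {n q p : ℕ} {x y : (Urep n q n).V p} (h : uval n q p x = uval n q p y) :
    x = y := Subtype.ext h

theorem uval_eq_zero {n q p : ℕ} (h : ¬ (1 ≤ p ∧ q ≤ p ∧ p ≤ n)) (x : (Urep n q n).V p) :
    x = 0 := by
  have hx : uval n q p x ∈ Uspace n q n p := x.2
  generalize hc : uval n q p x = c at hx
  rw [Uspace, if_neg (by unfold Ucond; omega), Submodule.mem_bot] at hx
  exact uval_inj (by rw [hc, hx, map_zero])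

theorem exists_uval {n q p : ℕ} (h : 1 ≤ p ∧ q ≤ p ∧ p ≤ n) (c : ℂ) :
    ∃ x, uval n q p x = c := by
  have h1 : c ∈ Uspace n q n p := by
    rw [Uspace, if_pos (by unfold Ucond; omega)]; trivial
  exact ⟨⟨c, h1⟩, rfl⟩

theorem uval_f {n q p : ℕ} (h : 1 ≤ p ∧ q ≤ p ∧ p + 1 ≤ n) (x : (Urep n q n).V p) :
    uval n q (p + 1) ((Urep n q n).f p x) = uval n q p x := by
  change (if Ucond n q n p ∧ Ucond n q n (p + 1) then (LinearMap.id : ℂ →ₗ[ℂ] ℂ) else 0) 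
    (uval n q p x) = uval n q p x
  rw [if_pos (by unfold Ucond; omega)]
  rfl

theorem hom_apply {M : ARep n} {q : ℕ} (hq : 1 ≤ q) (hqn : q ≤ n) (ι : ARepHom (Urep n q n) M) :
    ∃ v : M.V q, ∀ p (x : (Urep n q n).V p), ι.φ p x = uval n q p x • M.G q p v := by
  obtain ⟨x1, hx1⟩ := exists_uval (n := n) (q := q) (p := q) ⟨hq, le_rfl, hqn⟩ 1
  refine ⟨ι.φ q x1, fun p => ?_⟩
  have zero : ∀ p (x : (Urep n q n).V p), ¬ (1 ≤ p ∧ q ≤ p ∧ p ≤ n) → 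
      ι.φ p x = uval n q p x • M.G q p (ι.φ q x1) := by
    intro p x hp
    rw [uval_eq_zero hp x, map_zero, map_zero, zero_smul]
  by_cases hp : q ≤ p
  · induction p, hp using Nat.le_induction with
    | base =>
      intro x
      rw [G_self, LinearMap.id_apply, ← map_smul]
      congr 1
      apply uval_inj
      rw [map_smul, hx1, smul_eq_mul, mul_one]
    | succ p hp ih =>
      intro x
      by_cases hpn : p + 1 ≤ n
      · obtain ⟨x', hx'⟩ := exists_uval (n := n) (q := q) (p := p) (by omega) (uval n q (p + 1) x)
        have e : x = (Urep n q n).f p x' := by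
          apply uval_inj
          rw [uval_f (by omega), hx']
        have := LinearMap.congr_fun (ι.comm p) x'
        rw [LinearMap.comp_apply, LinearMap.comp_apply, ← e, ih, map_smul, hx'] at this
        rw [this, G_succ _ hp, LinearMap.comp_apply]
      · exact zero _ x (by omega)
  · intro x
    exact zero p x (by omega)

/-- The morphism determined by a vector. -/
noncomputable def homOf {q : ℕ} (v : M.V q) : ARepHom (Urep n q n) M where
  φ p := (LinearMap.toSpanSingleton ℂ (M.V p) (M.G q p v)).comp (uval n q p)
  comm p := by
    ext x
    by_cases h : 1 ≤ p ∧ q ≤ p ∧ p + 1 ≤ n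
    · simp only [LinearMap.comp_apply, uval_f h, G_succ _ h.2.1, 
        LinearMap.toSpanSingleton_apply, map_smul]
    · by_cases hp : n < p + 1
      · have := M.triv (p + 1) (Or.inr hp)
        exact Subsingleton.elim _ _
      · rw [uval_eq_zero (by omega) x, map_zero, map_zero]

theorem homOf_apply {q : ℕ} (v : M.V q) (p : ℕ) (x : (Urep n q n).V p) :
    (M.homOf v).φ p x = uval n q p x • M.G q p v := rfl

theorem homOf_injective {q : ℕ} (v : M.V q) (hv : M.G q n v ≠ 0) (p : ℕ) :
    Function.Injective ((M.homOf v).φ p) := by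
  rw [injective_iff_map_eq_zero]
  intro x hx
  by_cases h : 1 ≤ p ∧ q ≤ p ∧ p ≤ n
  · rw [homOf_apply] at hx
    rcases smul_eq_zero.mp hx with h0 | h0
    · exact uval_inj (by rw [h0, map_zero])
    · rw [← M.G_comp h.2.1 h.2.2, h0, map_zero] at hv
      exact absurd rfl hv
  · exact uval_eq_zero h x

theorem range_eq {M : ARep n} {q : ℕ} {ι : ARepHom (Urep n q n) M} {v : M.V q}
    (hι : ∀ p (x : (Urep n q n).V p), ι.φ p x = uval n q p x • M.G q p v) (p : ℕ) : 
    LinearMap.range (ι.φ p) = ℂ ∙ M.G q p v := by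
  apply le_antisymm
  · rintro _ ⟨x, rfl⟩
    rw [hι]
    exact Submodule.smul_mem _ _ (Submodule.mem_span_singleton_self _)
  · rw [Submodule.span_singleton_le_iff_mem]
    by_cases h : 1 ≤ p ∧ q ≤ p ∧ p ≤ n
    · obtain ⟨x, hx⟩ := exists_uval h 1
      exact ⟨x, by rw [hι, hx, one_smul]⟩
    · by_cases hp : q ≤ p
      · have := M.triv p (by omega)
        rw [Subsingleton.elim (M.G q p v) 0]
        exact zero_mem _
      · rw [G_lt _ (by omega)]
        exact zero_mem _

theorem mem_perpAt {M : ARep n} {ε : ℂ} {E : EpsForm n M ε} {q : ℕ} 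
    {ι : ARepHom (Urep n q n) M} {v : M.V q}
    (hι : ∀ p (x : (Urep n q n).V p), ι.φ p x = uval n q p x • M.G q p v) {p p' : ℕ} (hp : p + p' = n + 1)
    (y : M.V p) : y ∈ perpAt E ι p ↔ E.b p p' y (M.G q p' v) = 0 := by
  constructor
  · intro h
    apply h
    rw [range_eq hι]
    exact Submodule.mem_span_singleton_self _
  · intro h t x hx
    rw [range_eq hι, Submodule.mem_span_singleton] at hx
    obtain ⟨c, rfl⟩ := hx
    rw [← EpsForm.b_apply]
    by_cases e : t = p'
    · subst e
      rw [map_smul, h, smul_zero]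
    · exact E.b_graded (by omega) _ _

theorem partA (ε : ℂ) (hsplit : (Odd n ∧ ε = -1) ∨ (Even n ∧ ε = 1))
    {M : ARep n} (E : EpsForm n M ε) (q : ℕ) (hq : 1 ≤ q) (hqn : q ≤ n) (ι : ARepHom (Urep n q n) M) :
      ((∀ (p p' : ℕ) (x : M.V p) (y : M.V p'), x ∈ LinearMap.range (ι.φ p) →
          y ∈ LinearMap.range (ι.φ p') → E.B (Pi.single p x) (Pi.single p' y) = 0) ∧
       (∀ m : (∀ i, M.V i),
          (∀ x : (∀ i, M.V i), (∀ p, x p ∈ LinearMap.range (ι.φ p)) → E.B m x = 0) ↔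
          (∀ p, m p ∈ perpAt E ι p)) ∧
       (∀ (p : ℕ) (y : M.V p), y ∈ perpAt E ι p → M.f p y ∈ perpAt E ι (p + 1)) ∧
       (∀ p : ℕ, LinearMap.range (ι.φ p) ≤ perpAt E ι p)) := by
  obtain ⟨v, hι⟩ := hom_apply hq hqn ι
  have iso : ∀ (p p' : ℕ) (x : M.V p) (y : M.V p'), x ∈ LinearMap.range (ι.φ p) →
          y ∈ LinearMap.range (ι.φ p') → E.B (Pi.single p x) (Pi.single p' y) = 0 := by
    intro p p' x y hx hy
    rw [range_eq hι, Submodule.mem_span_singleton] at hx hy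
    obtain ⟨c, rfl⟩ := hx
    obtain ⟨d, rfl⟩ := hy
    rw [← EpsForm.b_apply, map_smul, map_smul, LinearMap.smul_apply, E.isotropic hsplit]
    simp
  refine ⟨iso, fun m => ⟨fun h p p' x hx => ?_, fun h x hx => ?_⟩, fun p y hy => ?_, 
    fun p x hx p' y hy => iso p p' x y hx hy⟩
  · have _h := hq
    by_cases e : p + p' = n + 1
    · have h1 := h (Pi.single p' x) (by
        intro j
        by_cases hj : j = p'
        · subst hj; simpa using hx
        · rw [Pi.single_eq_of_ne hj]; exact zero_mem _)
      rw [EpsForm.sum_single m, map_sum, LinearMap.sum_apply] at h1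
      by_cases hp : p ∈ Finset.range (n + 1)
      · rwa [Finset.sum_eq_single_of_mem p hp] at h1
        intro j _ hj
        exact E.b_graded (by omega) _ _
      · have := M.triv p (Or.inr (by simpa using hp))
        rw [Subsingleton.elim (m p) 0]; simp
    · exact E.b_graded e _ _
  · rw [EpsForm.sum_single m, EpsForm.sum_single x, map_sum]
    refine Finset.sum_eq_zero fun j _ => ?_
    rw [map_sum, LinearMap.sum_apply]
    exact Finset.sum_eq_zero fun i _ => h i j (x j) (hx j)
  · by_cases hp : p + 1 ≤ n
    · rw [mem_perpAt hι (p' := n - p) (by omega)]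
      rw [mem_perpAt hι (p' := n - p + 1) (by omega)] at hy
      rw [E.b_f, neg_eq_zero]
      by_cases hqp : q ≤ n - p
      · rwa [G_succ _ hqp] at hy
      · rw [G_lt _ (by omega)]; simp
    · have := M.triv (p + 1) (by omega)
      rw [Subsingleton.elim (M.f p y) 0]
      exact zero_mem _

theorem subquot_F (P S : ∀ k, Submodule ℂ (M.V k))
    (hSP : ∀ k, S k ≤ P k)
    (hP : ∀ k, ∀ x ∈ P k, M.f k x ∈ P (k + 1))
    (hS : ∀ k, ∀ x ∈ S k, M.f k x ∈ S (k + 1)) (k d : ℕ) (x : P k) :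
    ∃ h : M.F k d x.1 ∈ P (k + d), 
      (M.subquot P S hSP hP hS).F k d (Submodule.Quotient.mk x) 
        = Submodule.Quotient.mk ⟨M.F k d x.1, h⟩ := by
  induction d with
  | zero => exact ⟨x.2, rfl⟩
  | succ d ih =>
    obtain ⟨h, e⟩ := ih
    refine ⟨hP _ _ h, ?_⟩
    exact congrArg ((M.subquot P S hSP hP hS).f (k + d)) e

theorem subquot_r (P S : ∀ k, Submodule ℂ (M.V k))
    (hSP : ∀ k, S k ≤ P k)
    (hP : ∀ k, ∀ x ∈ P k, M.f k x ∈ P (k + 1))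
    (hS : ∀ k, ∀ x ∈ S k, M.f k x ∈ S (k + 1)) {k l : ℕ} (hkl : k ≤ l) :
    (M.subquot P S hSP hP hS).r k l + 
      finrank ℂ ((S l).comap ((P k).map (M.G k l)).subtype) = finrank ℂ ((P k).map (M.G k l)) := by
  obtain ⟨d, rfl⟩ := Nat.exists_eq_add_of_le hkl
  rw [r, Nat.add_sub_cancel_left, ← F_eq_G]
  have hA : (P k).map (M.F k d) ≤ P (k + d) := by
    rintro _ ⟨x, hx, rfl⟩
    exact (M.subquot_F P S hSP hP hS k d ⟨x, hx⟩).1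
  let ψ : ((P k).map (M.F k d)) →ₗ[ℂ] (P (k + d) ⧸ (S (k + d)).comap (P (k + d)).subtype) :=
    (Submodule.mkQ _).comp (Submodule.inclusion hA)
  have h1 := LinearMap.finrank_range_add_finrank_ker ψ
  have h2 : LinearMap.ker ψ = (S (k + d)).comap ((P k).map (M.F k d)).subtype := by
    ext x
    simp only [ψ, LinearMap.mem_ker, LinearMap.comp_apply, Submodule.mkQ_apply,
      Submodule.Quotient.mk_eq_zero, Submodule.mem_comap]
    rfl
  have h3 : LinearMap.range ((M.subquot P S hSP hP hS).F k d) = LinearMap.range ψ := by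
    apply le_antisymm
    · rintro _ ⟨x, rfl⟩
      obtain ⟨x, rfl⟩ := Submodule.Quotient.mk_surjective _ x
      obtain ⟨h, e⟩ := M.subquot_F P S hSP hP hS k d x
      exact ⟨⟨M.F k d x.1, x.1, x.2, rfl⟩, e.symm⟩
    · rintro _ ⟨⟨_, x, hx, rfl⟩, rfl⟩
      obtain ⟨h, e⟩ := M.subquot_F P S hSP hP hS k d ⟨x, hx⟩
      exact ⟨_, e⟩
  rw [h2] at h1
  rw [← h1, ← h3]
  rfl

theorem finrank_comap_span {V : Type} [AddCommGroup V] [Module ℂ V] (A : Submodule ℂ V) (s : V)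
    (hs : s ≠ 0) (h : s ∈ A) : finrank ℂ ((ℂ ∙ s).comap A.subtype) = 1 := by
  have hle : (ℂ ∙ s) ≤ A := by rwa [Submodule.span_singleton_le_iff_mem]
  rw [(Submodule.comapSubtypeEquivOfLe hle).finrank_eq, finrank_span_singleton hs]

theorem finrank_comap_span' {V : Type} [AddCommGroup V] [Module ℂ V] (A : Submodule ℂ V) (s : V)
    (h : s = 0 ∨ s ∉ A) : finrank ℂ ((ℂ ∙ s).comap A.subtype) = 0 := by
  have : (ℂ ∙ s).comap A.subtype = ⊥ := by
    rw [Submodule.eq_bot_iff]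
    rintro ⟨x, hx⟩ hx'
    rw [Submodule.mem_comap, Submodule.subtype_apply, Submodule.mem_span_singleton] at hx'
    obtain ⟨c, hc⟩ := hx'
    apply Subtype.ext
    change c • s = x at hc
    change x = 0
    rcases h with rfl | h
    · rw [← hc, smul_zero]
    · by_cases h0 : c = 0
      · rw [← hc, h0, zero_smul]
      · exact absurd ((Submodule.smul_mem_iff _ h0).mp (hc ▸ hx)) h
  rw [this, finrank_bot]

/-- A generic vector. -/
theorem exists_generic {M : ARep n} {ε : ℂ} (E : EpsForm n M ε) {q : ℕ} (hqn : q ≤ n)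
    (h0 : M.G q n ≠ 0) : ∃ v : M.V q, M.G q n v ≠ 0 ∧ 
    (∀ k l, k ≤ l → l ≤ n → M.G q l v ∈ LinearMap.range (M.G k l) → 
      LinearMap.range (M.G q l) ≤ LinearMap.range (M.G k l)) ∧
    (∀ k l, k ≤ n → l ≤ n → k ≤ n + 1 - q →
      (∀ y ∈ LinearMap.ker (M.G k l), E.b k (n + 1 - k) y (M.G q (n + 1 - k) v) = 0) →
      LinearMap.ker (M.G k l) ≤ LinearMap.ker (M.G k (n + 1 - q))) := by
  let W1 : ℕ × ℕ → Submodule ℂ (M.V q) := fun a => 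
    (LinearMap.range (M.G a.1 a.2)).comap (M.G q a.2)
  let W2 : ℕ × ℕ → Submodule ℂ (M.V q) := fun a => 
    ⨅ y ∈ LinearMap.ker (M.G a.1 a.2), 
      LinearMap.ker ((E.b a.1 (n + 1 - a.1) y).comp (M.G q (n + 1 - a.1)))
  let R : Finset (ℕ × ℕ) := Finset.range (n + 1) ×ˢ Finset.range (n + 1)
  obtain ⟨v, hv⟩ := exists_avoid 
    (({LinearMap.ker (M.G q n)} ∪ (W1 '' (R : Set (ℕ × ℕ)) ∪ W2 '' (R : Set (ℕ × ℕ)))) \ {⊤})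
    (Set.Finite.sdiff ((Set.finite_singleton _).union 
      ((R.finite_toSet.image _).union (R.finite_toSet.image _)))) (by simp)
  have hR : ∀ k l, k ≤ n → l ≤ n → (k, l) ∈ (R : Set (ℕ × ℕ)) := by
    intro k l hk hl
    simp only [R, Finset.coe_product, Set.mem_prod, Finset.mem_coe, Finset.mem_range]
    omega
  refine ⟨v, ?_, ?_, ?_⟩
  · intro h
    refine hv _ ⟨Or.inl rfl, ?_⟩ h
    intro ht
    exact h0 (LinearMap.ker_eq_top.mp ht)
  · intro k l hk hl h
    by_contra hc
    refine hv (W1 (k, l)) ⟨Or.inr (Or.inl ⟨_, hR k l (by omega) hl, rfl⟩), ?_⟩ h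
    intro ht
    apply hc
    rintro _ ⟨x, rfl⟩
    have : x ∈ W1 (k, l) := by rw [ht]; trivial
    exact this
  · intro k l hk hl hkq h
    by_contra hc
    refine hv (W2 (k, l)) ⟨Or.inr (Or.inr ⟨_, hR k l hk hl, rfl⟩), ?_⟩ ?_
    · intro ht
      apply hc
      intro y hy
      rw [LinearMap.mem_ker]
      refine E.b_nondeg (p' := q) (by omega) _ fun x => ?_
      rw [E.b_G_zero (i' := n + 1 - k) hkq (by omega)]
      have : x ∈ W2 (k, l) := by rw [ht]; trivial
      simp only [W2, Submodule.mem_iInf] at this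
      exact this y hy
    · simp only [W2, Submodule.mem_iInf]
      exact h

theorem mem_map_perp {M : ARep n} {ε : ℂ} (E : EpsForm n M ε)
    (hsplit : (Odd n ∧ ε = -1) ∨ (Even n ∧ ε = 1)) {q k l : ℕ} (v : M.V q) 
    (hkl : k ≤ l) (hl : l ≤ n) (hql : q ≤ l)
    (hr : LinearMap.range (M.G q l) ≤ LinearMap.range (M.G k l)) :
    M.G q l v ∈ (LinearMap.ker ((E.b k (n + 1 - k)).flip (M.G q (n + 1 - k) v))).map (M.G k l) := by
  set φ := (E.b k (n + 1 - k)).flip (M.G q (n + 1 - k) v) with hφ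
  by_cases hc : φ ≠ 0 ∧ LinearMap.ker (M.G k l) ≤ LinearMap.ker φ
  · obtain ⟨hc1, hc⟩ := hc
    have hqk' : q ≤ n + 1 - k := by
      by_contra hlt
      apply hc1
      rw [hφ, G_lt _ (by omega)]
      simp
    by_cases hqk : q ≤ k
    · exact ⟨M.G q k v, E.isotropic hsplit v, M.G_comp hqk hkl v⟩
    · obtain ⟨w, hw⟩ := hr ⟨v, rfl⟩
      refine ⟨w, ?_, hw⟩
      change E.b k (n + 1 - k) w (M.G q (n + 1 - k) v) = 0
      by_cases hlk : l ≤ n + 1 - k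
      · rw [← M.G_comp hql hlk, ← hw, M.G_comp hkl hlk]
        have := E.isotropic hsplit (p := k) (p' := n + 1 - k) w
        rwa [G_self] at this
      · obtain ⟨u, hu⟩ := E.mem_range_of_perp (k := k) (l := l) (k' := n + 1 - k) (l' := n + 1 - l)
          (by omega) (by omega) hkl (M.G q (n + 1 - k) v) (fun y hy => hc hy)
        rw [← hu, ← E.b_G_zero hkl (by omega), hw, ← M.G_comp hqk' (by omega : n + 1 - k ≤ l), ← hu, 
          M.G_comp (by omega) (by omega)]
        have := E.isotropic hsplit (p := l) (p' := n + 1 - l) u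
        rwa [M.G_self (n + 1 - l)] at this
  · rw [map_ker_eq_range _ _ hc]
    exact hr ⟨v, rfl⟩

end ARep

theorem perp_quotient_rank_sequence (n : ℕ) (ε : ℂ)
    (hsplit : (Odd n ∧ ε = -1) ∨ (Even n ∧ ε = 1))
    (M : ARep n) (E : EpsForm n M ε) (q : ℕ) (hq : 1 ≤ q) (hqn : q ≤ n)
    (hembed : ∃ ι : ARepHom (Urep n q n) M, ∀ k, Function.Injective (ι.φ k)) :
    ((∀ ι : ARepHom (Urep n q n) M, (∀ k, Function.Injective (ι.φ k)) →
      ((∀ (p p' : ℕ) (x : M.V p) (y : M.V p'), x ∈ LinearMap.range (ι.φ p) →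
          y ∈ LinearMap.range (ι.φ p') → E.B (Pi.single p x) (Pi.single p' y) = 0) ∧
       (∀ m : (∀ i, M.V i),
          (∀ x : (∀ i, M.V i), (∀ p, x p ∈ LinearMap.range (ι.φ p)) → E.B m x = 0) ↔
          (∀ p, m p ∈ perpAt E ι p)) ∧
       (∀ (p : ℕ) (y : M.V p), y ∈ perpAt E ι p → M.f p y ∈ perpAt E ι (p + 1)) ∧
       (∀ p : ℕ, LinearMap.range (ι.φ p) ≤ perpAt E ι p)))) ∧
    (∃ (ι : ARepHom (Urep n q n) M) (_ : ∀ k, Function.Injective (ι.φ k))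
       (hSP : ∀ k, LinearMap.range (ι.φ k) ≤ perpAt E ι k)
       (hP : ∀ k, ∀ x ∈ perpAt E ι k, M.f k x ∈ perpAt E ι (k + 1))
       (hS : ∀ k, ∀ x ∈ LinearMap.range (ι.φ k), M.f k x ∈ LinearMap.range (ι.φ (k + 1))),
       ∀ k l, 1 ≤ k → k ≤ l → l ≤ n →
         ((M.subquot (fun p => perpAt E ι p) (fun p => LinearMap.range (ι.φ p)) hSP hP hS).r k l : ℤ) =
           if (q ≤ l ∧ M.r q l ≤ M.r k l) ∧ (k ≤ n + 1 - q ∧ M.r k (n + 1 - q) ≤ M.r k l) then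
             (M.r k l : ℤ) - 2
           else if (q ≤ l ∧ M.r q l ≤ M.r k l) ∨ (k ≤ n + 1 - q ∧ M.r k (n + 1 - q) ≤ M.r k l) then
             (M.r k l : ℤ) - 1
           else (M.r k l : ℤ)) := by
  refine ⟨fun ι _ => ARep.partA ε hsplit E q hq hqn ι, ?_⟩
  have h0 : M.G q n ≠ 0 := by
    obtain ⟨ι, hι⟩ := hembed
    obtain ⟨v, hv⟩ := ARep.hom_apply hq hqn ι
    intro hG
    obtain ⟨x, hx⟩ := ARep.exists_uval (n := n) (q := q) (p := n) (by omega) 1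
    have h2 : ι.φ n x = 0 := by rw [hv, hG]; simp
    have h3 := (injective_iff_map_eq_zero _).mp (hι n) _ h2
    rw [h3, map_zero] at hx
    exact zero_ne_one hx
  obtain ⟨v, hv0, g1, g2⟩ := ARep.exists_generic E hqn h0
  have hι := M.homOf_apply v
  obtain ⟨a1, a2, a3, a4⟩ := ARep.partA ε hsplit E q hq hqn (M.homOf v)
  refine ⟨M.homOf v, M.homOf_injective v hv0, a4, a3, ?_, ?_⟩
  · intro k x hx
    obtain ⟨y, rfl⟩ := hx
    exact ⟨_, LinearMap.congr_fun ((M.homOf v).comm k) y⟩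
  intro k l hk hkl hl
  have hGne : ∀ p, q ≤ p → p ≤ n → M.G q p v ≠ 0 := by
    intro p hp hpn h
    apply hv0
    rw [← M.G_comp hp hpn, h, map_zero]
  have hr := M.subquot_r (fun p => perpAt E (M.homOf v) p)
    (fun p => LinearMap.range ((M.homOf v).φ p)) a4 a3 (by
      intro k x hx
      obtain ⟨y, rfl⟩ := hx
      exact ⟨_, LinearMap.congr_fun ((M.homOf v).comm k) y⟩) hkl
  set φ := (E.b k (n + 1 - k)).flip (M.G q (n + 1 - k) v) with hφ
  have hPk : perpAt E (M.homOf v) k = LinearMap.ker φ := by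
    ext y
    rw [ARep.mem_perpAt hι (p' := n + 1 - k) (by omega)]
    rfl
  generalize (M.subquot (fun p => perpAt E (M.homOf v) p)
    (fun p => LinearMap.range ((M.homOf v).φ p)) _ _ _).r k l = ρ at hr ⊢
  beta_reduce at hr
  rw [hPk, ARep.range_eq hι l] at hr
  have c2 : (k ≤ n + 1 - q ∧ M.r k (n + 1 - q) ≤ M.r k l) ↔
      (φ ≠ 0 ∧ LinearMap.ker (M.G k l) ≤ LinearMap.ker φ) := by
    constructor
    · rintro ⟨h1, h2⟩
      rw [M.r_le_iff_ker hkl h1] at h2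
      refine ⟨fun h => ?_, fun y hy => ?_⟩
      · refine hGne (n + 1 - k) (by omega) (by omega) 
          (E.b_nondeg' (p := k) (by omega) _ fun x => ?_)
        exact LinearMap.congr_fun h x
      · have := h2 hy
        rw [LinearMap.mem_ker] at this
        change E.b k (n + 1 - k) y (M.G q (n + 1 - k) v) = 0
        rw [← E.b_G_zero h1 (by omega), this]
        simp
    · rintro ⟨h1, h2⟩
      have hkq : k ≤ n + 1 - q := by
        by_contra hlt
        apply h1
        rw [hφ, M.G_lt (by omega)]
        simp
      refine ⟨hkq, ?_⟩
      rw [M.r_le_iff_ker hkl hkq]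
      exact g2 k l (by omega) hl hkq fun y hy => h2 hy
  have c1 : (q ≤ l ∧ M.r q l ≤ M.r k l) ↔
      (q ≤ l ∧ M.G q l v ∈ (LinearMap.ker φ).map (M.G k l)) := by
    constructor
    · rintro ⟨h1, h2⟩
      rw [M.r_le_iff_range hkl h1] at h2
      exact ⟨h1, ARep.mem_map_perp E hsplit v hkl hl h1 h2⟩
    · rintro ⟨h1, h2⟩
      refine ⟨h1, ?_⟩
      rw [M.r_le_iff_range hkl h1]
      exact g1 k l hkl hl (LinearMap.map_le_range h2)
  have d1 : (q ≤ l ∧ M.r q l ≤ M.r k l) →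
      finrank ℂ ((ℂ ∙ M.G q l v).comap ((LinearMap.ker φ).map (M.G k l)).subtype) = 1 := by
    intro h
    have h' := c1.mp h
    exact ARep.finrank_comap_span _ _ (hGne l h.1 hl) h'.2
  have d1' : ¬ (q ≤ l ∧ M.r q l ≤ M.r k l) →
      finrank ℂ ((ℂ ∙ M.G q l v).comap ((LinearMap.ker φ).map (M.G k l)).subtype) = 0 := by
    intro h
    rw [c1] at h
    apply ARep.finrank_comap_span'
    by_cases hql : q ≤ l
    · exact Or.inr fun h' => h ⟨hql, h'⟩
    · exact Or.inl (by rw [M.G_lt (by omega)]; rfl)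
  have d2 : (k ≤ n + 1 - q ∧ M.r k (n + 1 - q) ≤ M.r k l) →
      finrank ℂ ((LinearMap.ker φ).map (M.G k l)) + 1 = M.r k l := by
    intro h
    have h' := c2.mp h
    rw [M.r_eq hkl]
    exact ARep.finrank_map_ker _ _ h'.1 h'.2
  have d2' : ¬ (k ≤ n + 1 - q ∧ M.r k (n + 1 - q) ≤ M.r k l) →
      finrank ℂ ((LinearMap.ker φ).map (M.G k l)) = M.r k l := by
    intro h
    rw [c2] at h
    rw [M.r_eq hkl, ARep.map_ker_eq_range _ _ h]
  clear_value φ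
  generalize finrank ℂ ((ℂ ∙ M.G q l v).comap ((LinearMap.ker φ).map (M.G k l)).subtype) = A
    at hr d1 d1'
  generalize finrank ℂ ((LinearMap.ker φ).map (M.G k l)) = B at hr d2 d2'
  by_cases C1 : (q ≤ l ∧ M.r q l ≤ M.r k l) <;>
  by_cases C2 : (k ≤ n + 1 - q ∧ M.r k (n + 1 - q) ≤ M.r k l)
  · rw [if_pos ⟨C1, C2⟩]
    have := d1 C1
    have := d2 C2
    omega
  · rw [if_neg (fun h => C2 h.2), if_pos (Or.inl C1)]
    have := d1 C1
    have := d2' C2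
    omega
  · rw [if_neg (fun h => C1 h.1), if_pos (Or.inr C2)]
    have := d1' C1
    have := d2 C2
    omega
  · rw [if_neg (fun h => C1 h.1), if_neg (fun h => h.elim C1 C2)]
    have := d1' C1
    have := d2' C2
    omega
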